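/- Let u ≠ 0 in ℝⁿ, F = {x ∈ ℝⁿ : ⟨x,u⟩ = 0}, F₁ = {x ∈ ℝⁿ : ⟨x,u⟩ = 1}, and let A be a real symmetric n×n matrix of strict negative type on F but not of negative type on ℝⁿ. Let M = sup_{x ∈ F₁} ⟨Ax,x⟩ and let z ∈ F₁ be the unique element with ⟨Az,z⟩ = M. Then Az = M·u and M = ⟨A⁻¹u, u⟩⁻¹. -/

import Mathlib

open Matrix

namespace Matrix

/-- Expansion of the quadratic form of a symmetric matrix at a sum. -/
lemma IsSymm.mulVec_add_dotProduct_add {ι R : Type*} [Fintype ι] [CommRing R] {A : Matrix ι ι R}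
    (hA : A.IsSymm) (x h : ι → R) :
    A *ᵥ (x + h) ⬝ᵥ (x + h) = A *ᵥ x ⬝ᵥ x + 2 * (A *ᵥ x ⬝ᵥ h) + A *ᵥ h ⬝ᵥ h := by
  have hsymm : A *ᵥ h ⬝ᵥ x = A *ᵥ x ⬝ᵥ h := by
    rw [dotProduct_comm, dotProduct_mulVec, ← mulVec_transpose, hA.eq]
  simp only [mulVec_add, add_dotProduct, dotProduct_add, hsymm]
  ring

/-- A symmetric matrix of strict negative type on the hyperplane orthogonal to `u`, but not of
negative type on the whole space, is nonsingular. -/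
lemma IsSymm.isUnit_det_of_strict_negative_type {ι : Type*} [Fintype ι] [DecidableEq ι]
    {A : Matrix ι ι ℝ} (hA : A.IsSymm) (u : ι → ℝ)
    (hneg : ∀ x : ι → ℝ, x ⬝ᵥ u = 0 → A *ᵥ x ⬝ᵥ x ≤ 0)
    (hstrict : ∀ x : ι → ℝ, x ⬝ᵥ u = 0 → A *ᵥ x ⬝ᵥ x = 0 → x = 0)
    (hnot : ∃ w : ι → ℝ, 0 < A *ᵥ w ⬝ᵥ w) : IsUnit A.det := by
  rw [isUnit_iff_ne_zero]
  intro hdet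
  obtain ⟨x, hx, hAx⟩ := exists_mulVec_eq_zero_iff.mpr hdet
  obtain ⟨w, hw⟩ := hnot
  have hxu : x ⬝ᵥ u ≠ 0 := fun h => hx (hstrict x h (by simp [hAx]))
  set t := w ⬝ᵥ u / x ⬝ᵥ u with ht
  have hF : (w - t • x) ⬝ᵥ u = 0 := by
    rw [sub_dotProduct, smul_dotProduct, smul_eq_mul, ht, div_mul_cancel₀ _ hxu, sub_self]
  have hle := hneg _ hF
  have hexp := hA.mulVec_add_dotProduct_add (t • x) (w - t • x)
  rw [add_sub_cancel, mulVec_smul, hAx, smul_zero, zero_dotProduct, zero_dotProduct] at hexp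
  linarith

end Matrix

/-- With `M = sup_{x ∈ F₁} ⟨Ax,x⟩` and `z` the unique maximal element of `F₁`,
we have `Az = M·u` and `M = ⟨A⁻¹u,u⟩⁻¹`. -/
theorem gap_maximal_element_eq {n : ℕ} (u : Fin n → ℝ) (hu : u ≠ 0)
    (A : Matrix (Fin n) (Fin n) ℝ) (hA : A.IsSymm)
    (hneg : ∀ x : Fin n → ℝ, x ⬝ᵥ u = 0 → A.mulVec x ⬝ᵥ x ≤ 0)
    (hstrict : ∀ x : Fin n → ℝ, x ⬝ᵥ u = 0 → A.mulVec x ⬝ᵥ x = 0 → x = 0)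
    (hnot : ∃ w : Fin n → ℝ, 0 < A.mulVec w ⬝ᵥ w)
    (M : ℝ) (hM : M = sSup {r : ℝ | ∃ x : Fin n → ℝ, x ⬝ᵥ u = 1 ∧ r = A.mulVec x ⬝ᵥ x})
    (z : Fin n → ℝ) (hz : z ⬝ᵥ u = 1) (hzM : A.mulVec z ⬝ᵥ z = M) :
    A.mulVec z = M • u ∧ M = (A⁻¹.mulVec u ⬝ᵥ u)⁻¹ := by
  have hdet := hA.isUnit_det_of_strict_negative_type u hneg hstrict hnot
  set y := A⁻¹ *ᵥ u with hy
  have hAy : A *ᵥ y = u := by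
    rw [hy, mulVec_mulVec, mul_nonsing_inv A hdet, one_mulVec]
  set s := y ⬝ᵥ u with hs
  have hs0 : s ≠ 0 := by
    intro h
    have hy0 : y = 0 := hstrict y h (by rw [hAy, dotProduct_comm, ← hs, h])
    exact hu (by rw [← hAy, hy0, mulVec_zero])
  have hz₀ : (s⁻¹ • y) ⬝ᵥ u = 1 := by
    rw [smul_dotProduct, smul_eq_mul, ← hs, inv_mul_cancel₀ hs0]
  have hAz₀ : A *ᵥ (s⁻¹ • y) = s⁻¹ • u := by rw [mulVec_smul, hAy]
  have hF : ∀ x : Fin n → ℝ, x ⬝ᵥ u = 1 → (x - s⁻¹ • y) ⬝ᵥ u = 0 := by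
    intro x hx
    rw [sub_dotProduct, hx, hz₀, sub_self]
  have hexp : ∀ x : Fin n → ℝ, x ⬝ᵥ u = 1 →
      A *ᵥ x ⬝ᵥ x = s⁻¹ + A *ᵥ (x - s⁻¹ • y) ⬝ᵥ (x - s⁻¹ • y) := by
    intro x hx
    have h := hA.mulVec_add_dotProduct_add (s⁻¹ • y) (x - s⁻¹ • y)
    rw [add_sub_cancel, hAz₀, smul_dotProduct, smul_dotProduct, dotProduct_comm u,
      dotProduct_comm u, hz₀, hF x hx] at h
    simpa using h
  have hgreatest : IsGreatest
      {r : ℝ | ∃ x : Fin n → ℝ, x ⬝ᵥ u = 1 ∧ r = A.mulVec x ⬝ᵥ x} s⁻¹ := by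
    refine ⟨⟨s⁻¹ • y, hz₀, by simpa using (hexp _ hz₀).symm⟩, ?_⟩
    rintro r ⟨x, hx, rfl⟩
    linarith [hexp x hx, hneg _ (hF x hx)]
  have hMs : M = s⁻¹ := hM.trans hgreatest.csSup_eq
  have hzz : z = s⁻¹ • y :=
    sub_eq_zero.mp (hstrict _ (hF z hz) (by linarith [hexp z hz]))
  exact ⟨by rw [hzz, hAz₀, hMs], hMs⟩
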